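/- arXiv:2603.29506 — 3 statements merged into one kernel-verified Lean document; each statement's English description precedes it below -/
import Mathlib

section
/- Let M, N, T be nonempty finite index types, B > 0, c_{m,t} > 0, κ_{m,n,t} > 0, ℓ_{m,n,t} ∈ ℝ, and for each player m let S_m be a nonempty compact convex subset of the functions N × T → ℝ. Define Ũ_m(R) = Σ_{n,t}[R_{m,n,t} − c_{m,t}κ_{m,n,t}(2^{R_{m,n,t}/B} − 1) − ℓ_{m,n,t}R_{m,n,t}] and Φ(R) = Σ_m Ũ_m(R). Then: (i) there exists a unique profile R* ∈ Π_m S_m maximizing Φ over Π_m S_m; and (ii) a profile R ∈ Π_m S_m is a Nash equilibrium — meaning for every m and every s ∈ S_m, Ũ_m(the profile obtained from R by replacing block m with s) ≤ Ũ_m(R) — if and only if R = R*. -/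
/-- The map `r ↦ b ^ (r / B)` is strictly convex for a base `b > 1`. -/
theorem strictConvexOn_rpow_div {b B : ℝ} (hb : 1 < b) (hB : 0 < B) :
    StrictConvexOn ℝ Set.univ fun r : ℝ => b ^ (r / B) := by
  have hk : Real.log b / B ≠ 0 := (div_pos (Real.log_pos hb) hB).ne'
  have hexp : ∀ r : ℝ, b ^ (r / B) = Real.exp (Real.log b / B * r) := fun r => by
    rw [Real.rpow_def_of_pos (one_pos.trans hb)]
    congr 1
    ring
  refine ⟨convex_univ, fun x _ y _ hxy p q hp hq hpq => ?_⟩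
  have h := strictConvexOn_exp.2 (Set.mem_univ (Real.log b / B * x))
    (Set.mem_univ (Real.log b / B * y)) (fun h => hxy (mul_left_cancel₀ hk h)) hp hq hpq
  simp only [hexp, smul_eq_mul] at h ⊢
  convert h using 2
  ring

/-- Rate minus an exponential energy cost minus a linear penalty is strictly concave. -/
theorem strictConcaveOn_rate_utility {B a : ℝ} (hB : 0 < B) (ha : 0 < a) (l : ℝ) :
    StrictConcaveOn ℝ Set.univ fun r : ℝ => r - a * ((2 : ℝ) ^ (r / B) - 1) - l * r := by
  refine ⟨convex_univ, fun x hx y hy hxy p q hp hq hpq => ?_⟩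
  have h := mul_lt_mul_of_pos_left
    ((strictConvexOn_rpow_div one_lt_two hB).2 hx hy hxy hp hq hpq) ha
  obtain rfl : q = 1 - p := by linarith
  simp only [smul_eq_mul] at h ⊢
  linarith

/-- A separable sum of strictly concave functions is strictly concave. -/
theorem StrictConcaveOn.sum_apply {ι : Type*} [Fintype ι] {g : ι → ℝ → ℝ}
    (hg : ∀ i, StrictConcaveOn ℝ Set.univ (g i)) :
    StrictConcaveOn ℝ Set.univ fun x : ι → ℝ => ∑ i, g i (x i) := by
  refine ⟨convex_univ, fun x _ y _ hxy p q hp hq hpq => ?_⟩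
  obtain ⟨j, hj⟩ := Function.ne_iff.1 hxy
  simp only [Finset.smul_sum, ← Finset.sum_add_distrib]
  exact Finset.sum_lt_sum
    (fun i _ => (hg i).concaveOn.2 (Set.mem_univ _) (Set.mem_univ _) hp.le hq.le hpq)
    ⟨j, Finset.mem_univ j, (hg j).2 (Set.mem_univ _) (Set.mem_univ _) hj hp hq hpq⟩

/-- A strictly concave continuous function has a maximizer on a nonempty compact convex set, and
every maximizer agrees with it. -/
theorem StrictConcaveOn.exists_unique_isMaxOn {E : Type*} [AddCommGroup E] [Module ℝ E]
    [TopologicalSpace E] {s : Set E} {f : E → ℝ} (hf : StrictConcaveOn ℝ s f)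
    (hcont : ContinuousOn f s) (hs : IsCompact s) (hne : s.Nonempty) :
    ∃ x ∈ s, IsMaxOn f s x ∧ ∀ y ∈ s, IsMaxOn f s y → y = x := by
  obtain ⟨x, hx, hmax⟩ := hs.exists_isMaxOn hne hcont
  exact ⟨x, hx, hmax, fun y hy hy' => hf.eq_of_isMaxOn hy' hmax hy hx⟩


/-- Existence and uniqueness of the equilibrium (Claim 3 of Theorem 1 and
Corollary 1): over nonempty compact convex strategy sets `S_m`, the potential
`Φ = Σ_m Ũ_m` has a unique maximizer `R*`, and a profile is a Nash equilibrium
of the game with utilities `Ũ_m` if and only if it equals `R*`. -/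
theorem unique_equilibrium_is_potential_maximizer
    (M N T : Type*) [Fintype M] [Fintype N] [Fintype T] [DecidableEq M]
    [Nonempty M] [Nonempty N] [Nonempty T]
    (B : ℝ) (hB : 0 < B)
    (c : M → T → ℝ) (hc : ∀ m t, 0 < c m t)
    (κ : M → N → T → ℝ) (hκ : ∀ m n t, 0 < κ m n t)
    (ℓ : M → N → T → ℝ)
    (S : M → Set (N × T → ℝ))
    (hSne : ∀ m, (S m).Nonempty)
    (hScpt : ∀ m, IsCompact (S m))
    (hScvx : ∀ m, Convex ℝ (S m))
    (U : M → (M → N × T → ℝ) → ℝ)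
    (hU : ∀ m R, U m R = ∑ n : N, ∑ t : T,
      (R m (n, t) - c m t * κ m n t * ((2 : ℝ) ^ (R m (n, t) / B) - 1)
        - ℓ m n t * R m (n, t)))
    (Φ : (M → N × T → ℝ) → ℝ)
    (hΦ : ∀ R, Φ R = ∑ m : M, U m R) :
    ∃ Rstar : M → N × T → ℝ,
      (∀ m, Rstar m ∈ S m) ∧
      (∀ R : M → N × T → ℝ, (∀ m, R m ∈ S m) → Φ R ≤ Φ Rstar) ∧
      (∀ R : M → N × T → ℝ, (∀ m, R m ∈ S m) →
        (∀ Q : M → N × T → ℝ, (∀ m, Q m ∈ S m) → Φ Q ≤ Φ R) → R = Rstar) ∧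
      (∀ R : M → N × T → ℝ, (∀ m, R m ∈ S m) →
        ((∀ m, ∀ s ∈ S m, U m (Function.update R m s) ≤ U m R) ↔ R = Rstar)) := by
  let f : M → (N × T → ℝ) → ℝ := fun m x => ∑ i : N × T,
    (x i - c m i.2 * κ m i.1 i.2 * ((2 : ℝ) ^ (x i / B) - 1) - ℓ m i.1 i.2 * x i)
  have hUf : ∀ m R, U m R = f m (R m) := fun m R => by
    rw [hU]
    simp only [f, Fintype.sum_prod_type]
  have hconc : ∀ m, StrictConcaveOn ℝ Set.univ (f m) := fun m =>
    StrictConcaveOn.sum_apply fun i : N × T =>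
      strictConcaveOn_rate_utility hB (mul_pos (hc m i.2) (hκ m i.1 i.2)) (ℓ m i.1 i.2)
  have hcont : ∀ m, Continuous (f m) := fun m => by
    have hpow : Continuous fun r : ℝ => (2 : ℝ) ^ (r / B) :=
      (Real.continuous_const_rpow two_ne_zero).comp (continuous_id.div_const B)
    exact continuous_finsetSum _ fun i _ => by
      have := hpow.comp (continuous_apply (A := fun _ : N × T => ℝ) i)
      simp only [Function.comp_def] at this
      fun_prop
  choose x hxS hmax huniq using fun m =>
    ((hconc m).subset (Set.subset_univ _) (hScvx m)).exists_unique_isMaxOn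
      (hcont m).continuousOn (hScpt m) (hSne m)
  refine ⟨x, hxS, fun R hR => ?_, fun R hR hQ => ?_, fun R hR => ⟨fun h => ?_, ?_⟩⟩
  · simp only [hΦ, hUf]
    exact Finset.sum_le_sum fun m _ => hmax m (hR m)
  · have hle : ∀ m ∈ Finset.univ, f m (R m) ≤ f m (x m) := fun m _ => hmax m (hR m)
    have hsum : ∑ m, f m (R m) = ∑ m, f m (x m) := by
      have h := hQ x hxS
      simp only [hΦ, hUf] at h
      exact le_antisymm (Finset.sum_le_sum hle) h
    have heq := (Finset.sum_eq_sum_iff_of_le hle).1 hsum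
    funext m
    exact huniq m _ (hR m) fun s hs => (hmax m hs).trans (heq m (Finset.mem_univ m)).ge
  · funext m
    refine huniq m _ (hR m) fun s hs => ?_
    simpa only [Set.mem_ofPred_eq, hUf, Function.update_self] using h m s hs
  · rintro rfl m s hs
    simpa only [hUf, Function.update_self] using isMaxOn_iff.1 (hmax m) s hs
end

section
/- Let E be a real inner product space, S ⊆ E convex, α > 0, and Φ : E → ℝ α-strongly concave on S with maximizer R_MFE ∈ S. Let L ≥ 0, C ≥ 0 and let M ≥ 1 be a natural number. Suppose R^M ∈ S satisfies Φ(R^M) ≥ Φ(R_MFE) − δ^M for some δ^M with 0 ≤ δ^M ≤ 2LC/Real.sqrt M. Then ‖R^M − R_MFE‖ ≤ Real.sqrt(4LC/α) · M^{−1/4}, i.e., the strategy gap decays at rate O(M^{−1/4}). -/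
/-- Quadratic growth of a strongly concave function away from a maximizer. -/
theorem StrongConcaveOn.quadratic_growth_of_isMaxOn
    {E : Type*} [NormedAddCommGroup E] [NormedSpace ℝ E] {S : Set E} {m : ℝ} {f : E → ℝ}
    (hf : StrongConcaveOn S m f) {x y : E} (hx : x ∈ S) (hmax : IsMaxOn f S x) (hy : y ∈ S) :
    m / 2 * ‖y - x‖ ^ 2 ≤ f x - f y := by
  have hyx : f y ≤ f x := hmax hy
  have hineq : ∀ t : ℝ, 0 < t → t < 1 → (1 - t) * (m / 2 * ‖y - x‖ ^ 2) ≤ f x - f y := by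
    intro t ht0 ht1
    have h := hf.2 hy hx ht0.le (sub_nonneg.2 ht1.le) (by ring)
    have hle : f (t • y + (1 - t) • x) ≤ f x :=
      hmax (hf.1 hy hx ht0.le (sub_nonneg.2 ht1.le) (by ring))
    simp only [smul_eq_mul] at h
    refine le_of_mul_le_mul_left ?_ ht0
    linarith
  by_contra! hlt
  set K := m / 2 * ‖y - x‖ ^ 2
  have hK : 0 < K := by linarith
  have h := hineq ((K - (f x - f y)) / (2 * K)) (div_pos (by linarith) (by linarith))
    ((div_lt_one (by linarith)).2 (by linarith))
  have hmul : (1 - (K - (f x - f y)) / (2 * K)) * K = (K + (f x - f y)) / 2 := by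
    field_simp
    ring
  linarith


/-- Theorem 3(ii): NE-to-MFE strategy convergence at rate `O(M^{−1/4})`.
If `Φ` is `α`-strongly concave with maximizer `R_MFE` and `R^M` is a
`δ^M`-approximate maximizer with `δ^M ≤ 2LC/√M`, then
`‖R^M − R_MFE‖ ≤ √(4LC/α)·M^{−1/4}`. -/
theorem ne_to_mfe_strategy_convergence
    {E : Type*} [NormedAddCommGroup E] [InnerProductSpace ℝ E]
    (S : Set E) (hS : Convex ℝ S) (α : ℝ) (hα : 0 < α)
    (Φ : E → ℝ)
    (hconc : ConcaveOn ℝ S (fun x => Φ x + (α / 2) * ‖x‖ ^ 2))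
    (RMFE : E) (hRMFE : RMFE ∈ S)
    (hmax : ∀ x ∈ S, Φ x ≤ Φ RMFE)
    (L C : ℝ) (hL : 0 ≤ L) (hC : 0 ≤ C)
    (Mn : ℕ) (hM : 1 ≤ Mn)
    (RM : E) (hRM : RM ∈ S)
    (δM : ℝ) (hδ0 : 0 ≤ δM) (hδle : δM ≤ 2 * L * C / Real.sqrt Mn)
    (happrox : Φ RM ≥ Φ RMFE - δM) :
    ‖RM - RMFE‖ ≤ Real.sqrt (4 * L * C / α) * (Mn : ℝ) ^ (-(1 : ℝ) / 4) := by
  have hstrong : StrongConcaveOn S α Φ := strongConcaveOn_iff_convex.2 hconc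
  have hgrowth := hstrong.quadratic_growth_of_isMaxOn hRMFE hmax hRM
  have hM0 : (0 : ℝ) ≤ Mn := Nat.cast_nonneg Mn
  have hpow : ((Mn : ℝ) ^ (-(1 : ℝ) / 4)) ^ 2 = (√(Mn : ℝ))⁻¹ := by
    rw [← Real.rpow_natCast, ← Real.rpow_mul hM0, Real.sqrt_eq_rpow, ← Real.rpow_neg hM0]
    norm_num
  refine (sq_le_sq₀ (norm_nonneg _) (by positivity)).1 ?_
  rw [mul_pow, hpow, Real.sq_sqrt (by positivity)]
  calc ‖RM - RMFE‖ ^ 2 = 2 / α * (α / 2 * ‖RM - RMFE‖ ^ 2) := by field_simp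
    _ ≤ 2 / α * (2 * L * C / √(Mn : ℝ)) := by
      gcongr
      linarith
    _ = 4 * L * C / α * (√(Mn : ℝ))⁻¹ := by ring
end

section
/- Let D > 0 be the slot duration, T ≥ 1 a natural number (number of eclipse slots), and let C : ℕ → ℝ and P : ℕ → ℝ satisfy: C(0) ≥ 0; for every t < T, 0 ≤ P(t) and P(t) ≤ C(t)/((T − t)·D); and C(t+1) = C(t) − D·P(t). Then for every t ≤ T, C(t) ≥ C(0)·(T − t)/T; in particular C(t) ≥ 0 for all t ≤ T, so the battery is never depleted during the eclipse. -/
/-- Eclipse-period battery invariant: under the dynamic power cap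
`P(t) ≤ C(t)/((T − t)·D)` and the discrete battery dynamics
`C(t+1) = C(t) − D·P(t)`, the battery satisfies `C(t) ≥ C(0)·(T − t)/T`
for all `t ≤ T`; in particular the battery is never depleted. -/
theorem eclipse_battery_never_depleted
    (D : ℝ) (hD : 0 < D) (T : ℕ) (hT : 1 ≤ T)
    (C P : ℕ → ℝ)
    (hC0 : 0 ≤ C 0)
    (hP : ∀ t : ℕ, t < T → 0 ≤ P t ∧ P t ≤ C t / (((T : ℝ) - t) * D))
    (hdyn : ∀ t : ℕ, t < T → C (t + 1) = C t - D * P t) :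
    ∀ t : ℕ, t ≤ T →
      (C t ≥ C 0 * ((T : ℝ) - t) / T ∧ 0 ≤ C t) := by
  have hT0 : (0 : ℝ) < T := by exact_mod_cast hT
  have bound : ∀ t : ℕ, t ≤ T → C 0 / T * ((T : ℝ) - t) ≤ C t := by
    intro t
    induction t with
    | zero =>
      intro _
      simp [hT0.ne']
    | succ t ih =>
      intro ht
      have hr : (1 : ℝ) ≤ (T : ℝ) - t := by
        have : ((t + 1 : ℕ) : ℝ) ≤ T := by exact_mod_cast ht
        push_cast at this
        linarith
      have hr0 : (0 : ℝ) < (T : ℝ) - t := by linarith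
      have hcap : D * P t * ((T : ℝ) - t) ≤ C t := by
        have := (le_div_iff₀ (mul_pos hr0 hD)).1 (hP t ht).2
        linarith
      have hq : C 0 / T ≤ C t / ((T : ℝ) - t) := (le_div_iff₀ hr0).2 (ih (by omega))
      have hspent : D * P t ≤ C t / ((T : ℝ) - t) := (le_div_iff₀ hr0).2 hcap
      have hsplit : C t / ((T : ℝ) - t) * ((T : ℝ) - t) = C t := div_mul_cancel₀ _ hr0.ne'
      have hscaled := mul_le_mul_of_nonneg_right hq (sub_nonneg.2 hr)
      rw [hdyn t ht]
      push_cast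
      linarith
  intro t ht
  have hrem : (0 : ℝ) ≤ (T : ℝ) - t := sub_nonneg.2 (by exact_mod_cast ht)
  refine ⟨?_, (mul_nonneg (div_nonneg hC0 hT0.le) hrem).trans (bound t ht)⟩
  rw [ge_iff_le, mul_div_right_comm]
  exact bound t ht
end
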